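/- arXiv:2510.27235 — 3 statements merged into one kernel-verified Lean document; each statement's English description precedes it below -/
import Mathlib

section
/- Let V : ℝ³ → ℝ be measurable and β ≥ 0. For all u, w ∈ C¹_c(Ω) with ∫_Ω u² dx = ∫_Ω w² dx = 1 and such that V u² and V w² are integrable over Ω, one has |μ[u] − μ[w]| ≤ 2 |E(u) − E(w)| + (β/2) ‖u − w‖_{L²(Ω)} (‖u‖_{L⁶(Ω)} + ‖w‖_{L⁶(Ω)}) (‖u‖_{L⁶(Ω)}² + ‖w‖_{L⁶(Ω)}²). -/
open MeasureTheory Filter Topology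

noncomputable section

abbrev E3 := EuclideanSpace ℝ (Fin 3)

/-- The Gross–Pitaevskii chemical potential `μ[f]`. -/
def gpMu (V : E3 → ℝ) (β : ℝ) (Ω : Set E3) (f : E3 → ℝ) : ℝ :=
  (∫ x in Ω, (‖gradient f x‖ ^ 2 + V x * f x ^ 2 + β * f x ^ 4)) /
    (∫ x in Ω, f x ^ 2)

/-- The Gross–Pitaevskii energy `E(f)`. -/
def gpE (V : E3 → ℝ) (β : ℝ) (Ω : Set E3) (f : E3 → ℝ) : ℝ :=
  ∫ x in Ω, ((1 / 2) * ‖gradient f x‖ ^ 2 + (1 / 2) * V x * f x ^ 2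
    + (β / 4) * f x ^ 4)

/-- The `L^p(Ω)` norm, `1 ≤ p < ∞`. -/
def lpn (p : ℝ) (Ω : Set E3) (f : E3 → ℝ) : ℝ :=
  (∫ x in Ω, |f x| ^ p) ^ (1 / p)

/-- The `H¹(Ω)` norm. -/
def h1n (Ω : Set E3) (f : E3 → ℝ) : ℝ :=
  (∫ x in Ω, (f x ^ 2 + ‖gradient f x‖ ^ 2)) ^ (1 / (2 : ℝ))

/-- Membership in `C¹_c(Ω)`: continuously differentiable functions on `ℝ³`
whose support is a compact subset of `Ω`. -/
def IsC1c (Ω : Set E3) (f : E3 → ℝ) : Prop :=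
  ContDiff ℝ 1 f ∧ IsCompact (tsupport f) ∧ tsupport f ⊆ Ω

theorem IsC1c.continuous {Ω : Set E3} {f : E3 → ℝ} (hf : IsC1c Ω f) : Continuous f :=
  hf.1.continuous

theorem IsC1c.hasCompactSupport {Ω : Set E3} {f : E3 → ℝ} (hf : IsC1c Ω f) :
    HasCompactSupport f :=
  hf.2.1

theorem norm_gradient_eq_norm_fderiv (f : E3 → ℝ) (x : E3) : ‖gradient f x‖ = ‖fderiv ℝ f x‖ := by
  simp [gradient]

theorem IsC1c.integrable_norm_gradient_sq {Ω : Set E3} {f : E3 → ℝ} (hf : IsC1c Ω f) :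
    Integrable fun x => ‖gradient f x‖ ^ 2 := by
  simp only [norm_gradient_eq_norm_fderiv]
  have hc : Continuous fun x => ‖fderiv ℝ f x‖ ^ 2 :=
    (hf.1.continuous_fderiv one_ne_zero).norm.pow 2
  exact hc.integrable_of_hasCompactSupport <|
    (hf.hasCompactSupport.fderiv ℝ).comp_left (g := fun L => ‖L‖ ^ 2) (by simp)

theorem IsC1c.integrable_pow_four {Ω : Set E3} {f : E3 → ℝ} (hf : IsC1c Ω f) :
    Integrable fun x => f x ^ 4 := by
  have hc : HasCompactSupport fun x => f x ^ 4 :=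
    hf.hasCompactSupport.comp_left (g := fun t : ℝ => t ^ 4) (by simp)
  exact (hf.continuous.pow 4).integrable_of_hasCompactSupport hc

theorem IsC1c.memLp {Ω : Set E3} {f : E3 → ℝ} (hf : IsC1c Ω f) (p : ENNReal) :
    MemLp f p (volume.restrict Ω) :=
  (hf.continuous.memLp_of_hasCompactSupport hf.hasCompactSupport).restrict Ω

/-- For an `L²`-normalized function, the chemical potential is twice the energy plus the remaining
quartic term. -/
theorem gpMu_eq_two_mul_gpE_add {Ω : Set E3} {V : E3 → ℝ} (β : ℝ) {f : E3 → ℝ} (hf : IsC1c Ω f)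
    (hfn : ∫ x in Ω, f x ^ 2 = 1) (hfV : IntegrableOn (fun x => V x * f x ^ 2) Ω) :
    gpMu V β Ω f = 2 * gpE V β Ω f + β / 2 * ∫ x in Ω, f x ^ 4 := by
  have h4 := hf.integrable_pow_four.integrableOn (s := Ω)
  have hg := hf.integrable_norm_gradient_sq.integrableOn (s := Ω)
  have hE : IntegrableOn (fun x => (1 / 2) * ‖gradient f x‖ ^ 2 + (1 / 2) * V x * f x ^ 2
      + (β / 4) * f x ^ 4) Ω := by
    simp only [mul_assoc]
    exact ((hg.const_mul _).add (hfV.const_mul _)).add (h4.const_mul _)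
  rw [gpMu, gpE, hfn, div_one, ← integral_const_mul, ← integral_const_mul,
    ← integral_add (hE.const_mul _) (h4.const_mul _)]
  congr with x
  ring

theorem lpn_eq_toReal_eLpNorm {Ω : Set E3} {f : E3 → ℝ} {p : ENNReal} (hp : p ≠ 0) (hp' : p ≠ ⊤)
    (hf : MemLp f p (volume.restrict Ω)) :
    lpn p.toReal Ω f = (eLpNorm f p (volume.restrict Ω)).toReal := by
  rw [hf.eLpNorm_eq_integral_rpow_norm hp hp', ENNReal.toReal_ofReal (by positivity), lpn]
  simp

/-- Hölder's inequality for the difference of two fourth powers. -/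
theorem eLpNorm_pow_four_sub_pow_four_le {α : Type*} {m : MeasurableSpace α} {ν : Measure α}
    {u w : α → ℝ} (hu : AEStronglyMeasurable u ν) (hw : AEStronglyMeasurable w ν) :
    eLpNorm (fun x => u x ^ 4 - w x ^ 4) 1 ν ≤
      eLpNorm (fun x => u x - w x) 2 ν *
        ((eLpNorm u 6 ν + eLpNorm w 6 ν) * (eLpNorm u 6 ν ^ 2 + eLpNorm w 6 ν ^ 2)) := by
  have h663 : ENNReal.HolderTriple 6 6 3 := ⟨by
    rw [← ENNReal.toReal_eq_toReal_iff' (by simp) (by simp), ENNReal.toReal_add (by simp) (by simp)]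
    norm_num⟩
  have h632 : ENNReal.HolderTriple 6 3 2 := ⟨by
    rw [← ENNReal.toReal_eq_toReal_iff' (by simp) (by simp), ENNReal.toReal_add (by simp) (by simp)]
    norm_num⟩
  have hsq {f : α → ℝ} (hf : AEStronglyMeasurable f ν) :
      eLpNorm (f • f) 3 ν ≤ eLpNorm f 6 ν ^ 2 := by
    rw [sq]
    exact eLpNorm_smul_le_mul_eLpNorm hf hf
  have hfactor : (fun x => u x ^ 4 - w x ^ 4) =
      (fun x => u x - w x) • ((u + w) • (u • u + w • w)) := by
    ext x
    change _ = (u x - w x) * ((u x + w x) * (u x * u x + w x * w x))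
    ring
  have hsum := (hu.smul hu).add (hw.smul hw)
  rw [hfactor]
  refine (eLpNorm_smul_le_mul_eLpNorm (p := 2) (q := 2)
    ((hu.add hw).smul hsum) (hu.sub hw)).trans ?_
  refine mul_le_mul' le_rfl ?_
  refine (eLpNorm_smul_le_mul_eLpNorm (p := 6) (q := 3) hsum (hu.add hw)).trans ?_
  gcongr
  · exact eLpNorm_add_le hu hw (by norm_num)
  · exact (eLpNorm_add_le (hu.smul hu) (hw.smul hw) (by norm_num)).trans
      (add_le_add (hsq hu) (hsq hw))

theorem abs_integral_pow_four_sub_le {Ω : Set E3} {u w : E3 → ℝ} (hu : IsC1c Ω u)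
    (hw : IsC1c Ω w) :
    |(∫ x in Ω, u x ^ 4) - ∫ x in Ω, w x ^ 4| ≤
      lpn 2 Ω (fun x => u x - w x) *
        ((lpn 6 Ω u + lpn 6 Ω w) * (lpn 6 Ω u ^ 2 + lpn 6 Ω w ^ 2)) := by
  have h2 := (hu.memLp 2).sub (hw.memLp 2)
  have hu6 := hu.memLp 6
  have hw6 := hw.memLp 6
  have e2 := lpn_eq_toReal_eLpNorm (by norm_num) (by norm_num) h2
  have eu := lpn_eq_toReal_eLpNorm (by norm_num) (by norm_num) hu6
  have ew := lpn_eq_toReal_eLpNorm (by norm_num) (by norm_num) hw6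
  simp only [ENNReal.toReal_ofNat] at e2 eu ew
  have hint : IntegrableOn (fun x => u x ^ 4 - w x ^ 4) Ω :=
    (hu.integrable_pow_four.sub hw.integrable_pow_four).integrableOn
  have key := ENNReal.toReal_mono
    (ENNReal.mul_ne_top h2.eLpNorm_ne_top (ENNReal.mul_ne_top
      (ENNReal.add_ne_top.2 ⟨hu6.eLpNorm_ne_top, hw6.eLpNorm_ne_top⟩)
      (ENNReal.add_ne_top.2 ⟨ENNReal.pow_ne_top hu6.eLpNorm_ne_top,
        ENNReal.pow_ne_top hw6.eLpNorm_ne_top⟩)))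
    (eLpNorm_pow_four_sub_pow_four_le hu6.aestronglyMeasurable hw6.aestronglyMeasurable)
  rw [ENNReal.toReal_mul, ENNReal.toReal_mul,
    ENNReal.toReal_add hu6.eLpNorm_ne_top hw6.eLpNorm_ne_top,
    ENNReal.toReal_add (ENNReal.pow_ne_top hu6.eLpNorm_ne_top)
      (ENNReal.pow_ne_top hw6.eLpNorm_ne_top),
    ENNReal.toReal_pow, ENNReal.toReal_pow, ← eu, ← ew] at key
  rw [← integral_sub hu.integrable_pow_four.integrableOn hw.integrable_pow_four.integrableOn]
  refine (norm_integral_le_integral_norm (fun x => u x ^ 4 - w x ^ 4)).trans ?_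
  rw [integral_norm_eq_lintegral_enorm hint.aestronglyMeasurable, ← eLpNorm_one_eq_lintegral_enorm]
  exact key.trans_eq (congrArg (· * _) e2.symm)

theorem stmt6
    (Ω : Set E3) (hΩo : IsOpen Ω) (hΩb : Bornology.IsBounded Ω)
    (V : E3 → ℝ) (hVm : Measurable V)
    (β : ℝ) (hβ : 0 ≤ β)
    (u w : E3 → ℝ) (hu : IsC1c Ω u) (hw : IsC1c Ω w)
    (hun : ∫ x in Ω, u x ^ 2 = 1) (hwn : ∫ x in Ω, w x ^ 2 = 1)
    (huV : IntegrableOn (fun x => V x * u x ^ 2) Ω)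
    (hwV : IntegrableOn (fun x => V x * w x ^ 2) Ω) :
    |gpMu V β Ω u - gpMu V β Ω w| ≤
      2 * |gpE V β Ω u - gpE V β Ω w| +
        (β / 2) * lpn 2 Ω (fun x => u x - w x) *
          (lpn 6 Ω u + lpn 6 Ω w) * (lpn 6 Ω u ^ 2 + lpn 6 Ω w ^ 2) := by
  rw [gpMu_eq_two_mul_gpE_add β hu hun huV, gpMu_eq_two_mul_gpE_add β hw hwn hwV]
  calc
    _ = |2 * (gpE V β Ω u - gpE V β Ω w) +
          β / 2 * ((∫ x in Ω, u x ^ 4) - ∫ x in Ω, w x ^ 4)| := by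
      congr 1
      ring
    _ ≤ 2 * |gpE V β Ω u - gpE V β Ω w| +
          β / 2 * |(∫ x in Ω, u x ^ 4) - ∫ x in Ω, w x ^ 4| := by
      refine (abs_add_le _ _).trans_eq ?_
      rw [abs_mul, abs_mul, abs_two, abs_of_nonneg (by positivity : 0 ≤ β / 2)]
    _ ≤ _ := by
      rw [mul_assoc, mul_assoc]
      gcongr
      exact abs_integral_pow_four_sub_le hu hw
end
end

section
/- Let τ > 0 and B ≥ 0, and let (a_k), (b_k), (c_k), (γ_k) be sequences of nonnegative real numbers indexed by ℕ. Assume τ γ_k < 1 for every k, and set σ_k := (1 − τ γ_k)^{-1}. If for every n ∈ ℕ one has a_n + τ Σ_{k=0}^{n} γ_k b_k ≤ τ Σ_{k=0}^{n} γ_k a_k + τ Σ_{k=0}^{n} c_k + B, then for every n ∈ ℕ one has a_n + τ Σ_{k=0}^{n} γ_k b_k ≤ exp(τ Σ_{k=0}^{n} γ_k σ_k) · (τ Σ_{k=0}^{n} c_k + B). -/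
/-- The resolvent factor `(1 - x)⁻¹ = 1 + x (1 - x)⁻¹` is at most `exp (x (1 - x)⁻¹)`. -/
theorem inv_one_sub_le_exp {x : ℝ} (hx : x < 1) :
    (1 - x)⁻¹ ≤ Real.exp (x * (1 - x)⁻¹) := by
  have hne : 1 - x ≠ 0 := (sub_pos.2 hx).ne'
  calc (1 - x)⁻¹ = x * (1 - x)⁻¹ + 1 := by field_simp; ring
    _ ≤ _ := Real.add_one_le_exp _

/-- Implicit discrete Grönwall inequality for the accumulated right-hand side. -/
theorem implicit_discrete_gronwall {τ B : ℝ} (hτ : 0 ≤ τ) (hB : 0 ≤ B) {a c γ : ℕ → ℝ}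
    (hc : ∀ k, 0 ≤ c k) (hγ : ∀ k, 0 ≤ γ k) (hτγ : ∀ k, τ * γ k < 1)
    (h : ∀ n : ℕ, a n ≤ τ * ∑ k ∈ Finset.range (n + 1), γ k * a k
      + τ * ∑ k ∈ Finset.range (n + 1), c k + B) (n : ℕ) :
    τ * ∑ k ∈ Finset.range n, γ k * a k + τ * ∑ k ∈ Finset.range n, c k + B ≤
      Real.exp (τ * ∑ k ∈ Finset.range n, γ k * (1 - τ * γ k)⁻¹) *
        (τ * ∑ k ∈ Finset.range n, c k + B) := by
  induction n with
  | zero => simp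
  | succ n ih =>
    have hn := h n
    have hpos : 0 < 1 - τ * γ n := sub_pos.2 (hτγ n)
    have hF : 0 ≤ τ * ∑ k ∈ Finset.range n, c k + B :=
      add_nonneg (mul_nonneg hτ (Finset.sum_nonneg fun k _ => hc k)) hB
    have hexponent : 0 ≤ τ * ∑ k ∈ Finset.range n, γ k * (1 - τ * γ k)⁻¹ :=
      mul_nonneg hτ (Finset.sum_nonneg fun k _ =>
        mul_nonneg (hγ k) (inv_nonneg.2 (sub_pos.2 (hτγ k)).le))
    have hσ := inv_one_sub_le_exp (hτγ n)
    have hτc : 0 ≤ τ * c n := mul_nonneg hτ (hc n)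
    simp only [Finset.sum_range_succ, mul_add, Real.exp_add] at hn ⊢
    rw [← mul_assoc τ (γ n) (a n)] at hn ⊢
    rw [← mul_assoc τ (γ n) (1 - τ * γ n)⁻¹]
    set G := τ * ∑ k ∈ Finset.range n, γ k * a k
    set F := τ * ∑ k ∈ Finset.range n, c k
    set E := Real.exp (τ * ∑ k ∈ Finset.range n, γ k * (1 - τ * γ k)⁻¹)
    have hE : 1 ≤ E := Real.one_le_exp hexponent
    have hstep : G + τ * γ n * a n + (F + τ * c n) + B ≤
        (1 - τ * γ n)⁻¹ * (G + F + B + τ * c n) := by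
      rw [← div_eq_inv_mul, le_div_iff₀ hpos]
      linarith [mul_le_mul_of_nonneg_left hn (mul_nonneg hτ (hγ n))]
    have hsource : G + F + B + τ * c n ≤ E * (F + B + τ * c n) := by
      linarith [mul_le_mul_of_nonneg_right hE hτc]
    calc _ ≤ (1 - τ * γ n)⁻¹ * (G + F + B + τ * c n) := hstep
      _ ≤ (1 - τ * γ n)⁻¹ * (E * (F + B + τ * c n)) := by gcongr
      _ ≤ Real.exp (τ * γ n * (1 - τ * γ n)⁻¹) * (E * (F + B + τ * c n)) := by gcongr
      _ = _ := by ring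

theorem stmt13
    (τ B : ℝ) (hτ : 0 < τ) (hB : 0 ≤ B)
    (a b c γ : ℕ → ℝ)
    (ha : ∀ k, 0 ≤ a k) (hb : ∀ k, 0 ≤ b k)
    (hc : ∀ k, 0 ≤ c k) (hγ : ∀ k, 0 ≤ γ k)
    (hτγ : ∀ k, τ * γ k < 1)
    (h : ∀ n : ℕ,
      a n + τ * ∑ k ∈ Finset.range (n + 1), γ k * b k ≤
        τ * ∑ k ∈ Finset.range (n + 1), γ k * a k
          + τ * ∑ k ∈ Finset.range (n + 1), c k + B) :
    ∀ n : ℕ,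
      a n + τ * ∑ k ∈ Finset.range (n + 1), γ k * b k ≤
        Real.exp (τ * ∑ k ∈ Finset.range (n + 1), γ k * (1 - τ * γ k)⁻¹) *
          (τ * ∑ k ∈ Finset.range (n + 1), c k + B) := by
  intro n
  refine (h n).trans (implicit_discrete_gronwall hτ.le hB hc hγ hτγ (fun m => ?_) (n + 1))
  have hdissipation : 0 ≤ τ * ∑ k ∈ Finset.range (m + 1), γ k * b k :=
    mul_nonneg hτ.le (Finset.sum_nonneg fun k _ => mul_nonneg (hγ k) (hb k))
  linarith [h m]
end

section
/- Let u, v ∈ H with ‖u‖ = 1 and v ≠ 0. Then ‖u − v/‖v‖‖ ≤ ‖u − v‖ + 4 ‖u − v‖³. -/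
theorem stmt15 {H : Type*} [NormedAddCommGroup H] [InnerProductSpace ℝ H]
    (u v : H) (hu : ‖u‖ = 1) (hv : v ≠ 0) :
    ‖u - ‖v‖⁻¹ • v‖ ≤ ‖u - v‖ + 4 * ‖u - v‖ ^ 3 := by
  have hr : 0 < ‖v‖ := norm_pos_iff.mpr hv
  obtain ⟨w, hw⟩ : ∃ w, w = ‖v‖⁻¹ • v := ⟨_, rfl⟩
  have hvw : v = ‖v‖ • w := by rw [hw, smul_inv_smul₀ hr.ne']
  have hw1 : ‖w‖ = 1 := by
    rw [hw, norm_smul, norm_inv, norm_norm, inv_mul_cancel₀ hr.ne']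
  have ha := norm_sub_sq_real u w
  have hd := norm_sub_sq_real u v
  have hin : inner ℝ u v = ‖v‖ * inner ℝ u w := by
    conv_lhs => rw [hvw]
    rw [real_inner_smul_right]
  rw [hin, hu] at hd
  rw [hu, hw1] at ha
  rw [← hw]
  have hc : |inner ℝ u w| ≤ 1 := by simpa [hu, hw1] using abs_real_inner_le_norm u w
  obtain ⟨hc1, hc2⟩ := abs_le.mp hc
  have ha0 := norm_nonneg (u - w)
  have hd0 := norm_nonneg (u - v)
  generalize ‖u - w‖ = a at *
  generalize ‖u - v‖ = d at *
  generalize ‖v‖ = r at *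
  generalize inner ℝ u w = c at *
  rcases lt_or_ge c 0 with h | h
  · have hd1 : 1 ≤ d := by nlinarith [mul_pos hr (neg_pos.mpr h)]
    have : a ≤ 2 := by nlinarith
    nlinarith [one_le_pow₀ hd1 (n := 3)]
  · have h1 : 1 - c ^ 2 ≤ d ^ 2 := by nlinarith [sq_nonneg (r - c)]
    have h2 : 1 - c ≤ d ^ 2 := by nlinarith
    have h3 : (1 - c ^ 2) * (1 + 8 * (1 - c)) ≤ d ^ 2 * (1 + 8 * d ^ 2) := by
      gcongr
    have h4 : a ^ 2 ≤ (1 - c ^ 2) * (1 + 8 * (1 - c)) := by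
      have : 0 ≤ (1 - c) * ((1 + c) * (9 - 8 * c) - 2) :=
        mul_nonneg (by linarith) (by nlinarith)
      nlinarith
    refine le_of_abs_le (abs_le_of_sq_le_sq ?_ (by positivity))
    nlinarith [pow_nonneg hd0 6]
end
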